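/- Church-Fitch: in the classical bi-modal logic L described in the context, if the verificationist knowability schema A → ◇K A is added as an axiom schema, then for every formula A one can derive A → K A; in particular, for every formula p, L + {B → ◇K B : B a formula} ⊢ p → K p. -/

import Mathlib

/-- Formulas of classical bi-modal logic: atoms, ⊥, ∧, ∨, →, and two modal
operators `K` and `box`. `¬A` abbreviates `A → ⊥` and `◇A` abbreviates `¬□¬A`. -/
inductive Formula : Type
  | atom : ℕ → Formula
  | bot  : Formula
  | and  : Formula → Formula → Formula
  | or   : Formula → Formula → Formula
  | imp  : Formula → Formula → Formula
  | K    : Formula → Formula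
  | box  : Formula → Formula

namespace Formula
def neg (A : Formula) : Formula := A.imp bot
def dia (A : Formula) : Formula := (Formula.box A.neg).neg
end Formula

open Formula

/-- Boolean evaluation of a formula under an assignment `v` that directly
assigns truth values to atoms and to modal formulas (which are treated as
atoms for the purposes of propositional tautologies). -/
def eval (v : Formula → Bool) : Formula → Bool
  | .atom n => v (.atom n)
  | .bot => false
  | .and A B => eval v A && eval v B
  | .or A B => eval v A || eval v B
  | .imp A B => !eval v A || eval v B
  | .K A => v (.K A)
  | .box A => v (.box A)

/-- Classical propositional tautologies in the bi-modal language. -/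
def Taut (A : Formula) : Prop := ∀ v : Formula → Bool, eval v A = true

/-- The classical bi-modal logic: all classical propositional tautologies,
distribution for `K` and `□`, reflection `K A → A`, the verificationist
knowability schema `A → ◇K A`, modus ponens, and necessitation for both
`K` and `□`. -/
inductive CF : Formula → Prop
  | taut {A : Formula} : Taut A → CF A
  | distK {A B : Formula} : CF ((K (A.imp B)).imp ((K A).imp (K B)))
  | distBox {A B : Formula} : CF ((box (A.imp B)).imp ((box A).imp (box B)))
  | reflK {A : Formula} : CF ((K A).imp A)
  | know {A : Formula} : CF (A.imp (K A).dia)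
  | mp {A B : Formula} : CF (A.imp B) → CF A → CF B
  | necK {A : Formula} : CF A → CF (K A)
  | necBox {A : Formula} : CF A → CF (box A)

namespace CF

theorem K_mono {A B : Formula} (h : CF (A.imp B)) : CF ((K A).imp (K B)) :=
  mp distK (necK h)

/-- No one can know a Moorean conjunction `A ∧ ¬K A`. -/
theorem not_K_and_neg_K (A : Formula) : CF (K (A.and (K A).neg)).neg := by
  have hK : CF ((K (A.and (K A).neg)).imp (K A)) :=
    K_mono (taut fun v => by simp only [eval]; grind)
  refine mp (mp (taut fun v => ?_) hK) (reflK (A := A.and (K A).neg))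
  simp only [eval, neg]
  grind

/-- The knowability schema refutes every formula that provably cannot be known. -/
theorem neg_of_neg_K {A : Formula} (h : CF (K A).neg) : CF A.neg := by
  refine mp (mp (taut fun v => ?_) (know (A := A))) (necBox h)
  simp only [eval, neg, dia]
  grind

end CF

theorem church_fitch : ∀ p : Formula, CF (p.imp (K p)) := by
  intro p
  refine CF.mp (CF.taut fun v => ?_) (CF.neg_of_neg_K (CF.not_K_and_neg_K p))
  simp only [eval, neg]
  grind
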